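/- Let A be a commutative ℕ-graded ring with A₀ a field k, and let B be a graded A-algebra with B₀ = k. Suppose that Tor_i^A(B, k) is a finite-dimensional k-vector space for all i (B is 'FT over A'), and let M be a B-module such that Tor_q^B(M, k) is finite-dimensional for all q. Then Tor_n^A(M, k) is finite-dimensional for all n. -/

import Mathlib

open CategoryTheory

namespace CategoryTheory

open Limits

variable {C D : Type*} [Category* C] [Abelian C] [Category* D] [Abelian D]

namespace ChainComplex

variable (K : ChainComplex C ℕ) (n : ℕ)

/-- The map from the cokernel of the incoming differential onto the image of the outgoing one. -/
noncomputable abbrev opcyclesToImage :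
    K.opcycles (n + 1) ⟶ Abelian.image (K.fromOpcycles (n + 1) n) :=
  Abelian.factorThruImage (K.fromOpcycles (n + 1) n)

lemma homologyι_comp_opcyclesToImage : K.homologyι (n + 1) ≫ opcyclesToImage K n = 0 := by
  rw [← cancel_mono (Abelian.image.ι _)]
  simp

lemma shortExact_homology_opcycles_image :
    (ShortComplex.mk _ _ (homologyι_comp_opcyclesToImage K n)).ShortExact where
  exact := by
    let S' := ShortComplex.mk _ _ (K.homologyι_comp_fromOpcycles (n + 1) n)
    let φ : ShortComplex.mk _ _ (homologyι_comp_opcyclesToImage K n) ⟶ S' :=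
      { τ₁ := 𝟙 _, τ₂ := 𝟙 _, τ₃ := Abelian.image.ι _ }
    rw [ShortComplex.exact_iff_of_epi_of_isIso_of_mono φ]
    exact S'.exact_of_f_is_kernel (K.homologyIsKernel (n + 1) n (by simp))
  mono_f := by dsimp; infer_instance
  epi_g := by dsimp; infer_instance

lemma image_ι_comp_pOpcycles :
    Abelian.image.ι (K.fromOpcycles (n + 1) n) ≫ K.pOpcycles n = 0 := by
  rw [← cancel_epi (opcyclesToImage K n), ← cancel_epi (K.pOpcycles (n + 1))]
  simp

lemma shortExact_image_opcycles :
    (ShortComplex.mk _ _ (image_ι_comp_pOpcycles K n)).ShortExact where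
  exact := by
    let S' := ShortComplex.mk _ _ (K.d_pOpcycles (n + 1) n)
    let φ : S' ⟶ ShortComplex.mk _ _ (image_ι_comp_pOpcycles K n) :=
      { τ₁ := K.pOpcycles (n + 1) ≫ opcyclesToImage K n, τ₂ := 𝟙 _, τ₃ := 𝟙 _ }
    have : Epi φ.τ₁ := epi_comp _ _
    rw [← ShortComplex.exact_iff_of_epi_of_isIso_of_mono φ]
    exact S'.exact_of_g_is_cokernel (K.opcyclesIsCokernel (n + 1) n (by simp))
  mono_f := by dsimp; infer_instance
  epi_g := by dsimp; infer_instance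

/-- A right exact functor commutes with the cokernels of the differentials of a complex. -/
lemma exists_opcycles_iso_map (G : C ⥤ D) [G.Additive] [PreservesFiniteColimits G] :
    ∃ e : ((G.mapHomologicalComplex _).obj K).opcycles n ≅ G.obj (K.opcycles n),
      ((G.mapHomologicalComplex _).obj K).pOpcycles n ≫ e.hom = G.map (K.pOpcycles n) := by
  have h₁ := ((G.mapHomologicalComplex _).obj K).opcyclesIsCokernel (n + 1) n (by simp)
  have h₂ := isColimitCoforkMapOfIsColimit' G _ (K.opcyclesIsCokernel (n + 1) n (by simp))
  refine ⟨h₁.coconePointUniqueUpToIso h₂, ?_⟩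
  exact h₁.comp_coconePointUniqueUpToIso_hom h₂ WalkingParallelPair.one

lemma prop_homology_succ_map_iff (P : ObjectProperty D) [P.IsSerreClass] (G : C ⥤ D) [G.Additive]
    [PreservesFiniteColimits G] :
    P (((G.mapHomologicalComplex _).obj K).homology (n + 1)) ↔
      P.monoModSerre (G.map (K.fromOpcycles (n + 1) n)) := by
  obtain ⟨e, he⟩ := ChainComplex.exists_opcycles_iso_map K (n + 1) G
  let L := (G.mapHomologicalComplex _).obj K
  have fac : L.fromOpcycles (n + 1) n = e.hom ≫ G.map (K.fromOpcycles (n + 1) n) := by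
    refine (cancel_epi (L.pOpcycles (n + 1))).1 ?_
    refine (L.p_fromOpcycles (n + 1) n).trans (Eq.trans ?_ (Category.assoc _ _ _))
    rw [he]
    exact (congrArg G.map (K.p_fromOpcycles (n + 1) n)).symm.trans (G.map_comp _ _)
  have e₁ : L.homology (n + 1) ≅ kernel (L.fromOpcycles (n + 1) n) :=
    (L.homologyIsKernel (n + 1) n (by simp)).conePointUniqueUpToIso (limit.isLimit _)
  have e₂ : kernel (L.fromOpcycles (n + 1) n) ≅ kernel (G.map (K.fromOpcycles (n + 1) n)) :=
    kernelIsoOfEq fac ≪≫ kernelIsIsoComp _ _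
  exact P.prop_iff_of_iso (e₁ ≪≫ e₂)

end ChainComplex

/-- The formal properties, with respect to a right exact functor `G` and a Serre class `P`, of the
conditions `t q X : P (L_{q+1} G X)`, where objects in `Fl` are acyclic. -/
structure IsLeftDerivedCondition (P : ObjectProperty D) [P.IsSerreClass] (G : C ⥤ D)
    (Fl : ObjectProperty C) (t : ℕ → ObjectProperty C) : Prop where
  extension (q : ℕ) {S : ShortComplex C} (hS : S.ShortExact) : t q S.X₁ → t q S.X₃ → t q S.X₂
  succ_iff (q : ℕ) {S : ShortComplex C} (hS : S.ShortExact) (h : Fl S.X₂) :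
    t (q + 1) S.X₃ ↔ t q S.X₁
  zero_iff {S : ShortComplex C} (hS : S.ShortExact) (h : Fl S.X₂) :
    t 0 S.X₃ ↔ P.monoModSerre (G.map S.f)
  closedUnderIso (q : ℕ) : (t q).IsClosedUnderIsomorphisms

namespace IsLeftDerivedCondition

variable {P : ObjectProperty D} [P.IsSerreClass] {G : C ⥤ D} {Fl : ObjectProperty C}
  {t : ℕ → ObjectProperty C} (h : IsLeftDerivedCondition P G Fl t) {K : ChainComplex C ℕ}
  (hK : ∀ n, Fl (K.X n))

include h hK

lemma opcycles (hH : ∀ q n, t q (K.homology n)) (n q : ℕ) : t q (K.opcycles n) := by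
  have := h.closedUnderIso
  induction n generalizing q with
  | zero => exact (t q).prop_of_iso K.isoHomologyι₀ (hH q 0)
  | succ n ih =>
    refine h.extension q (ChainComplex.shortExact_homology_opcycles_image K n) (hH q (n + 1)) ?_
    exact (h.succ_iff q (ChainComplex.shortExact_image_opcycles K n) (hK n)).1 (ih (q + 1))

variable [G.Additive] [PreservesFiniteColimits G]

theorem homology_map (hH : ∀ q n, t q (K.homology n)) (hG : ∀ n, P (G.obj (K.homology n))) (n : ℕ) :
    P (((G.mapHomologicalComplex _).obj K).homology n) := by
  cases n with
  | zero =>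
    obtain ⟨e, -⟩ := ChainComplex.exists_opcycles_iso_map K 0 G
    exact P.prop_of_iso
      (G.mapIso K.isoHomologyι₀ ≪≫ e.symm ≪≫
        (ChainComplex.isoHomologyι₀ ((G.mapHomologicalComplex _).obj K)).symm) (hG 0)
  | succ n =>
    rw [ChainComplex.prop_homology_succ_map_iff K n P G]
    have hS₁ := ChainComplex.shortExact_homology_opcycles_image K n
    have hS₂ := ChainComplex.shortExact_image_opcycles K n
    rw [← Abelian.image.fac (K.fromOpcycles (n + 1) n), G.map_comp]
    refine P.monoModSerre.comp_mem _ _ ?_ ?_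
    · have := hS₁.epi_g
      have hex := hS₁.exact.map_of_epi_of_preservesCokernel G inferInstance inferInstance
      have hepi := (ShortComplex.exact_iff_epi_kernel_lift _).1 hex
      exact @ObjectProperty.prop_of_epi _ _ P _ _ _ _ hepi (hG (n + 1))
    · exact (h.zero_iff hS₂ (hK n)).1 (h.opcycles hK hH n 0)

theorem opcycles_iff (hH : ∀ n, IsZero (K.homology (n + 1))) (n q : ℕ) :
    t q (K.opcycles n) ↔ P (((G.mapHomologicalComplex _).obj K).homology (n + q + 1)) := by
  have := h.closedUnderIso
  induction q generalizing n with
  | zero =>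
    have hS₁ := ChainComplex.shortExact_homology_opcycles_image K n
    have := hS₁.isIso_g_iff.2 (hH n)
    rw [h.zero_iff (ChainComplex.shortExact_image_opcycles K n) (hK n)]
    refine Iff.trans ?_ (ChainComplex.prop_homology_succ_map_iff K n P G).symm
    conv_rhs => rw [← Abelian.image.fac (K.fromOpcycles (n + 1) n), G.map_comp]
    exact (P.prop_iff_of_iso (kernelIsIsoComp (G.map (ChainComplex.opcyclesToImage K n)) _)).symm
  | succ q ih =>
    have hS₁ := ChainComplex.shortExact_homology_opcycles_image K n
    have := hS₁.isIso_g_iff.2 (hH n)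
    rw [h.succ_iff q (ChainComplex.shortExact_image_opcycles K n) (hK n)]
    refine ((t q).prop_iff_of_iso (asIso (ChainComplex.opcyclesToImage K n))).symm.trans ?_
    refine (ih (n + 1)).trans ?_
    rw [show n + 1 + q + 1 = n + (q + 1) + 1 by ring]

end IsLeftDerivedCondition

end CategoryTheory

section TorLES

open MonoidalCategory Limits

universe u

variable {R : Type u} [CommRing R]

namespace ModuleCat

instance flat_of_projective (X : ModuleCat.{u} R) [Projective X] : Module.Flat R X :=
  have := projective_of_module_projective X
  inferInstance

/-- The functor `N ↦ Q ⊗ N` from modules to complexes. -/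
noncomputable def tensorComplex (Q : ChainComplex (ModuleCat.{u} R) ℕ) :
    ModuleCat.{u} R ⥤ ChainComplex (ModuleCat.{u} R) ℕ where
  obj N := ((tensorRight N).mapHomologicalComplex _).obj Q
  map f := (NatTrans.mapHomologicalComplex ((tensoringRight _).map f) _).app Q
  map_id N := by
    ext i : 1
    exact whiskerLeft_id (Q.X i) N
  map_comp f g := by
    ext i : 1
    exact MonoidalCategory.whiskerLeft_comp (Q.X i) f g

instance (Q : ChainComplex (ModuleCat.{u} R) ℕ) : (tensorComplex Q).Additive where
  map_add {X Y f g} := by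
    ext i : 1
    exact MonoidalPreadditive.whiskerLeft_add (X := Q.X i) f g

variable {M : ModuleCat.{u} R} (Q : ProjectiveResolution M)

lemma shortExact_tensorComplex {S : ShortComplex (ModuleCat.{u} R)} (hS : S.ShortExact) :
    (S.map (tensorComplex Q.complex)).ShortExact := by
  refine HomologicalComplex.shortExact_of_degreewise_shortExact _ fun i ↦ ?_
  have : PreservesFiniteLimits (tensorLeft (Q.complex.X i)) :=
    (Module.Flat.iff_preservesFiniteLimits_tensorLeft _).1 inferInstance
  exact hS.map_of_exact (tensorLeft (Q.complex.X i))

lemma isZero_homology_tensorComplex (N : ModuleCat.{u} R) [Module.Flat R N] (n : ℕ) :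
    IsZero (((tensorComplex Q.complex).obj N).homology (n + 1)) := by
  rw [← HomologicalComplex.exactAt_iff_isZero_homology]
  exact Module.Flat.rTensor_shortComplex_exact N _ (Q.complex_exactAt_succ n)

/-- The augmentation `Q₀ ⊗ N ⟶ M ⊗ N`. -/
noncomputable def tensorComplexAugmentation (N : ModuleCat.{u} R) :
    ((tensorComplex Q.complex).obj N).X 0 ⟶ (tensorLeft M).obj N :=
  (tensorRight N).map (Q.π.f 0)

/-- The map from the cokernel of `Q₁ ⊗ N ⟶ Q₀ ⊗ N` to `M ⊗ N`. -/
noncomputable def opcyclesTensorComplex (N : ModuleCat.{u} R) :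
    ((tensorComplex Q.complex).obj N).opcycles 0 ⟶ (tensorLeft M).obj N :=
  Q.fromLeftDerivedZero' (tensorRight N)

instance (N : ModuleCat.{u} R) : IsIso (opcyclesTensorComplex Q N) :=
  inferInstanceAs (IsIso (Q.fromLeftDerivedZero' (tensorRight N)))

lemma pOpcycles_comp_opcyclesTensorComplex (N : ModuleCat.{u} R) :
    HomologicalComplex.pOpcycles _ 0 ≫ opcyclesTensorComplex Q N =
      tensorComplexAugmentation Q N :=
  Q.pOpcycles_comp_fromLeftDerivedZero' (tensorRight N)

lemma opcyclesMap_comp_opcyclesTensorComplex {X Y : ModuleCat.{u} R} (f : X ⟶ Y) :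
    HomologicalComplex.opcyclesMap ((tensorComplex Q.complex).map f) 0 ≫
      opcyclesTensorComplex Q Y = opcyclesTensorComplex Q X ≫ (tensorLeft M).map f := by
  rw [← cancel_epi (HomologicalComplex.pOpcycles _ _), HomologicalComplex.p_opcyclesMap_assoc,
    pOpcycles_comp_opcyclesTensorComplex, ← Category.assoc, pOpcycles_comp_opcyclesTensorComplex]
  exact whisker_exchange (Q.π.f 0) f

/-- The zeroth homology of `Q ⊗ N` is `M ⊗ N`, naturally in `N`. -/
noncomputable def homologyZeroTensorComplexIso :
    tensorComplex Q.complex ⋙ HomologicalComplex.homologyFunctor _ _ 0 ≅ tensorLeft M :=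
  NatIso.ofComponents
    (fun N ↦ ChainComplex.isoHomologyι₀ ((tensorComplex Q.complex).obj N) ≪≫
      asIso (opcyclesTensorComplex Q N))
    (fun {X Y} f ↦ by
      change HomologicalComplex.homologyMap ((tensorComplex Q.complex).map f) 0 ≫
          HomologicalComplex.homologyι _ 0 ≫ opcyclesTensorComplex Q Y =
        (HomologicalComplex.homologyι _ 0 ≫ opcyclesTensorComplex Q X) ≫ (tensorLeft M).map f
      rw [HomologicalComplex.homologyι_naturality_assoc, Category.assoc,
        opcyclesMap_comp_opcyclesTensorComplex])

/-- The condition that the homology of `Q ⊗ N` in degree `q + 1` belongs to a Serre class. -/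
def torCondition (P : ObjectProperty (ModuleCat.{u} R)) (q : ℕ) : ObjectProperty (ModuleCat.{u} R) :=
  fun N ↦ P (((tensorComplex Q.complex).obj N).homology (q + 1))

theorem isLeftDerivedCondition_torCondition (P : ObjectProperty (ModuleCat.{u} R))
    [P.IsSerreClass] :
    IsLeftDerivedCondition P (tensorLeft M) (fun N ↦ Module.Flat R N) (torCondition Q P) where
  extension q S hS h₁ h₃ :=
    P.prop_X₂_of_exact ((shortExact_tensorComplex Q hS).homology_exact₂ (q + 1)) h₁ h₃
  succ_iff q S hS h :=
    P.prop_iff_of_iso ((shortExact_tensorComplex Q hS).δIso (q + 2) (q + 1) (by simp)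
      (isZero_homology_tensorComplex Q S.X₂ (q + 1)) (isZero_homology_tensorComplex Q S.X₂ q))
  zero_iff {S} hS h := by
    have hS' := shortExact_tensorComplex Q hS
    have hij : (ComplexShape.down ℕ).Rel 1 0 := by simp
    have hmono := hS'.mono_δ 1 0 hij (isZero_homology_tensorComplex Q S.X₂ 0)
    have e₁ := (hS'.homology_exact₁ 1 0 hij).fIsKernel.conePointUniqueUpToIso
      (limit.isLimit _)
    have e₂ := kernel.mapIso (HomologicalComplex.homologyMap ((tensorComplex Q.complex).map S.f) 0)
      (M ◁ S.f) ((homologyZeroTensorComplexIso Q).app S.X₁)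
      ((homologyZeroTensorComplexIso Q).app S.X₂) ((homologyZeroTensorComplexIso Q).hom.naturality S.f)
    exact P.prop_iff_of_iso (e₁ ≪≫ e₂)
  closedUnderIso q :=
    ⟨fun e h ↦ P.prop_of_iso
      ((HomologicalComplex.homologyFunctor _ _ (q + 1)).mapIso ((tensorComplex Q.complex).mapIso e)) h⟩

end ModuleCat

end TorLES

section Finiteness

open MonoidalCategory Limits ZeroObject

universe u

namespace ModuleCat

section

variable {R : Type u} [CommRing R] (P : ObjectProperty (ModuleCat.{u} R)) [P.IsSerreClass]

/-- If the terms of `F` are flat and `Tor(M, -)` of its homology modules belongs to a Serre class,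
then so does the homology of `M ⊗ F`. The condition on `F` is phrased by means of a module `κ` from
which its homology is built by extensions. -/
theorem prop_homology_tensorLeft_map {M κ : ModuleCat.{u} R}
    (hM : ∀ q, P (((Tor (ModuleCat.{u} R) q).obj M).obj κ)) (F : ChainComplex (ModuleCat.{u} R) ℕ)
    (hF : ∀ n, Module.Flat R (F.X n))
    (hH : ∀ (U : ObjectProperty (ModuleCat.{u} R)) [U.IsClosedUnderExtensions]
      [U.IsClosedUnderIsomorphisms] [U.ContainsZero], U κ → ∀ n, U (F.homology n)) (n : ℕ) :
    P ((((tensorLeft M).mapHomologicalComplex _).obj F).homology n) := by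
  let Q := ProjectiveResolution.of M
  have hQ := isLeftDerivedCondition_torCondition Q P
  let U : ObjectProperty (ModuleCat.{u} R) :=
    fun N ↦ P ((tensorLeft M).obj N) ∧ ∀ q, torCondition Q P q N
  have : U.IsClosedUnderExtensions := ⟨fun {S} hS h₁ h₃ ↦ by
    have := hS.epi_g
    have := CategoryWithHomology.hasHomology (S.map (tensorLeft M))
    exact ⟨P.prop_X₂_of_exact (hS.exact.map_of_epi_of_preservesCokernel (tensorLeft M)
      inferInstance inferInstance) h₁.1 h₃.1, fun q ↦ hQ.extension q hS (h₁.2 q) (h₃.2 q)⟩⟩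
  have : U.IsClosedUnderIsomorphisms := ⟨fun e h ↦
    ⟨P.prop_of_iso ((tensorLeft M).mapIso e) h.1, fun q ↦
      have := hQ.closedUnderIso q
      (torCondition Q P q).prop_of_iso e (h.2 q)⟩⟩
  have : U.ContainsZero := ⟨0, isZero_zero _,
    P.prop_of_isZero ((tensorLeft M).map_isZero (isZero_zero _)), fun q ↦
      P.prop_of_isZero ((tensorComplex Q.complex ⋙
        HomologicalComplex.homologyFunctor _ _ (q + 1)).map_isZero (isZero_zero _))⟩
  have hκ : U κ := by
    refine ⟨P.prop_of_iso ((tensorLeft M).leftDerivedZeroIsoSelf.app κ) (hM 0), fun q ↦ ?_⟩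
    have := hQ.closedUnderIso q
    let L := ProjectiveResolution.of κ
    have e : L.complex.opcycles 0 ≅ κ :=
      (L.complex.opcyclesIsCokernel 1 0 (by simp)).coconePointUniqueUpToIso
        L.isColimitCokernelCofork
    refine (torCondition Q P q).prop_of_iso e ((hQ.opcycles_iff (K := L.complex)
      (fun n ↦ inferInstance) (fun n ↦ ?_) 0 q).2 ?_)
    · rw [← HomologicalComplex.exactAt_iff_isZero_homology]
      exact L.complex_exactAt_succ n
    · rw [Nat.zero_add]
      exact P.prop_of_iso (L.isoLeftDerivedObj (tensorLeft M) (q + 1)) (hM (q + 1))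
  have hU := hH U hκ
  exact hQ.homology_map hF (fun q n ↦ (hU n).2 q) (fun n ↦ (hU n).1) n

end

end ModuleCat

end Finiteness

section ChangeOfRings

open MonoidalCategory Limits TensorProduct

universe u

namespace ModuleCat

/-- The modules that are finite over the base ring. -/
def isFinite (k : Type u) [CommRing k] : ObjectProperty (ModuleCat.{u} k) :=
  fun N ↦ Module.Finite k N

instance (k : Type u) [CommRing k] [IsNoetherianRing k] : (isFinite k).IsSerreClass where
  exists_zero := ⟨.of k PUnit, isZero_of_subsingleton _, inferInstanceAs (Module.Finite k PUnit.{u + 1})⟩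
  prop_of_mono {M N} f hf hN := by
    rw [ModuleCat.mono_iff_injective] at hf
    have : Module.Finite k N := hN
    exact Module.Finite.of_injective f.hom hf
  prop_of_epi {M N} f hf hM := by
    rw [ModuleCat.epi_iff_surjective] at hf
    have : Module.Finite k M := hM
    exact Module.Finite.of_surjective f.hom hf
  prop_X₂_of_shortExact {S} hS h₁ h₃ := by
    have : Module.Finite k S.X₁ := h₁
    have : Module.Finite k S.X₃ := h₃
    have hg := hS.epi_g
    rw [ModuleCat.epi_iff_surjective] at hg
    have hfg := (ShortComplex.ShortExact.moduleCat_exact_iff_function_exact S).1 hS.exact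
    have : Module.Finite k (LinearMap.ker S.g.hom) :=
      LinearMap.exact_iff.1 hfg ▸ inferInstance
    have : Module.Finite k (S.X₂ ⧸ LinearMap.ker S.g.hom) :=
      Module.Finite.equiv (S.g.hom.quotKerEquivOfSurjective hg).symm
    exact Module.Finite.of_submodule_quotient (LinearMap.ker S.g.hom)

/-- The modules over a `k`-algebra that are finite over `k`. -/
abbrev isFiniteOver (k R : Type u) [CommRing k] [CommRing R] [Algebra k R] :
    ObjectProperty (ModuleCat.{u} R) :=
  (isFinite k).inverseImage (restrictScalars (algebraMap k R))

lemma isFiniteOver_iff {k R : Type u} [CommRing k] [CommRing R] [Algebra k R]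
    (N : ModuleCat.{u} R) [Module k N] [IsScalarTower k R N] :
    isFiniteOver k R N ↔ Module.Finite k N := by
  let e : (restrictScalars (algebraMap k R)).obj N ≃ₗ[k] N :=
    { AddEquiv.refl N with map_smul' := fun c x ↦ algebraMap_smul R c (show N from x) }
  exact Module.Finite.equiv_iff e

lemma finite_of_isFiniteOver {k R : Type u} [CommRing k] [CommRing R] [Algebra k R]
    (N : ModuleCat.{u} R) (h : isFiniteOver k R N) : Module.Finite R N := by
  let : Module k N := Module.compHom N (algebraMap k R)
  have : IsScalarTower k R N := IsScalarTower.of_algebraMap_smul fun _ _ ↦ rfl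
  have := (isFiniteOver_iff N).1 h
  exact Module.Finite.of_restrictScalars_finite k R N

lemma isFiniteOver_iff_of_iso {k A B : Type u} [CommRing k] [CommRing A] [CommRing B] [Algebra k A]
    [Algebra k B] [Algebra A B] [IsScalarTower k A B] {N : ModuleCat.{u} B} {T : ModuleCat.{u} A}
    (e : (restrictScalars (algebraMap A B)).obj N ≅ T) :
    isFiniteOver k B N ↔ isFiniteOver k A T :=
  Module.Finite.equiv_iff (((restrictScalarsComp' (algebraMap k A) (algebraMap A B)
    (algebraMap k B) (IsScalarTower.algebraMap_eq k A B)).app N ≪≫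
      (restrictScalars (algebraMap k A)).mapIso e).toLinearEquiv)

/-- An additive isomorphism that is semilinear gives an isomorphism from the restriction of
scalars. -/
noncomputable def restrictScalarsIsoOfAddEquiv {A B : Type u} [CommRing A] [CommRing B] (f : A →+* B)
    {N : ModuleCat.{u} B} {T : ModuleCat.{u} A} (e : N ≃+ T)
    (he : ∀ (a : A) (x : N), e (f a • x) = a • e x) : (restrictScalars f).obj N ≅ T :=
  let e' : (restrictScalars f).obj N ≃ₗ[A] T := { e with map_smul' := he }
  e'.toModuleIso

section

variable (A B : Type u) [CommRing A] [CommRing B] [Algebra A B]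

/-- The base change functor `X ↦ B ⊗ X`. -/
noncomputable def baseChange : ModuleCat.{u} A ⥤ ModuleCat.{u} B where
  obj X := of B (B ⊗[A] X)
  map f := ofHom (f.hom.baseChange B)
  map_id X := by
    ext : 1
    exact LinearMap.baseChange_id
  map_comp f g := by
    ext : 1
    exact LinearMap.baseChange_comp f.hom g.hom

instance : (baseChange A B).Additive where
  map_add {X Y f g} := by
    ext : 1
    exact LinearMap.baseChange_add f.hom g.hom

/-- Base change followed by restriction of scalars is tensoring with `B`. -/
noncomputable def baseChangeCompRestrictScalarsIso :
    baseChange A B ⋙ restrictScalars (algebraMap A B) ≅ tensorLeft (of A B) :=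
  NatIso.ofComponents (fun X ↦ restrictScalarsIsoOfAddEquiv (N := of B (B ⊗[A] X))
    (T := of A (B ⊗[A] X)) (algebraMap A B) (AddEquiv.refl (B ⊗[A] X))
    fun a x ↦ algebraMap_smul B a (show B ⊗[A] X from x)) (fun _ ↦ rfl)

/-- Base change followed by tensoring with a `B`-module `M` is tensoring with the underlying
`A`-module of `M`. -/
noncomputable def baseChangeCompTensorLeftIso (M : Type u) [AddCommGroup M] [Module A M]
    [Module B M] [IsScalarTower A B M] :
    (baseChange A B ⋙ tensorLeft (of B M)) ⋙ restrictScalars (algebraMap A B) ≅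
      tensorLeft (of A M) :=
  NatIso.ofComponents (fun X ↦ restrictScalarsIsoOfAddEquiv (N := of B (M ⊗[B] (B ⊗[A] X)))
    (T := of A (M ⊗[A] X)) (algebraMap A B)
    (AlgebraTensorModule.cancelBaseChange A B B M X).toAddEquiv
    fun a x ↦ ((AlgebraTensorModule.cancelBaseChange A B B M X).map_smul
        (algebraMap A B a) x).trans (algebraMap_smul B a _))
    (fun {X Y} f ↦ by
      ext x
      change AlgebraTensorModule.cancelBaseChange A B B M Y
          ((f.hom.baseChange B).lTensor M x) =
        f.hom.lTensor M (AlgebraTensorModule.cancelBaseChange A B B M X x)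
      induction (show M ⊗[B] (B ⊗[A] X) from x) using TensorProduct.induction_on with
      | zero => simp
      | add x y hx hy => simp [hx, hy]
      | tmul m y =>
        induction y using TensorProduct.induction_on with
        | zero => simp
        | add x y hx hy => simp only [TensorProduct.tmul_add, map_add, hx, hy]
        | tmul b x => simp)

end

/-- Restriction of scalars commutes with the homology of complexes. -/
noncomputable def restrictScalarsHomologyIso {A B : Type u} [CommRing A] [CommRing B] (f : A →+* B)
    {C : Type*} [Category* C] [Preadditive C] {Φ : C ⥤ ModuleCat.{u} B} {Ψ : C ⥤ ModuleCat.{u} A}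
    [Φ.Additive] [Ψ.Additive] (e : Φ ⋙ restrictScalars f ≅ Ψ) (K : ChainComplex C ℕ) (n : ℕ) :
    (restrictScalars f).obj (((Φ.mapHomologicalComplex _).obj K).homology n) ≅
      ((Ψ.mapHomologicalComplex _).obj K).homology n :=
  ((((Φ.mapHomologicalComplex _).obj K).sc n).mapHomologyIso (restrictScalars f)).symm ≪≫
    (HomologicalComplex.homologyFunctor _ _ n).mapIso
      ((NatIso.mapHomologicalComplex e _).app K)

/-- An ideal `I` annihilates `Tor (X, R ⧸ I)`. -/
lemma smul_tor_quotient_eq_zero {R : Type u} [CommRing R] (X : ModuleCat.{u} R) (I : Ideal R)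
    {a : R} (ha : a ∈ I) (n : ℕ)
    (x : ((Tor (ModuleCat.{u} R) n).obj X).obj (of R (R ⧸ I))) : a • x = 0 := by
  let Y := of R (R ⧸ I)
  let P := ProjectiveResolution.of Y
  have h0 : a • 𝟙 Y = 0 := by
    refine hom_ext (LinearMap.ext fun y ↦ ?_)
    obtain ⟨r, rfl⟩ := Ideal.Quotient.mk_surjective y
    exact Ideal.Quotient.eq_zero_iff_mem.2 (I.mul_mem_right r ha)
  have h1 : a • 𝟙 ((ChainComplex.single₀ _).obj Y) = 0 := by
    ext : 1
    exact h0
  have hπ : (a • 𝟙 P.complex) ≫ P.π = P.π ≫ (ChainComplex.single₀ _).map 0 := by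
    rw [Linear.smul_comp, Category.id_comp, Functor.map_zero, comp_zero,
      ← Category.comp_id P.π, ← Linear.comp_smul, h1, comp_zero]
  let H := ProjectiveResolution.liftHomotopy 0 (a • 𝟙 P.complex) 0 hπ (by simp)
  let K := ((tensorLeft X).mapHomologicalComplex (ComplexShape.down ℕ)).obj P.complex
  have h₂ : a • 𝟙 (K.homology n) = 0 := by
    have h₁ := ((tensorLeft X).mapHomotopy H).homologyMap_eq n
    rw [Functor.map_smul, Functor.map_zero, CategoryTheory.Functor.map_id, HomologicalComplex.homologyMap_zero]
      at h₁
    rw [← h₁, ← HomologicalComplex.homologyMap_id]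
    exact (ShortComplex.homologyMap_smul _ _).symm
  let e := (P.isoLeftDerivedObj (tensorLeft X) n).toLinearEquiv
  have h₃ : a • e x = 0 := LinearMap.congr_fun (congrArg Hom.hom h₂) (e x)
  exact e.injective ((e.map_smul a x).trans (h₃.trans e.map_zero.symm))

end ModuleCat

end ChangeOfRings

section ConnectedGraded

universe u

namespace GradedAlgebra

variable {k A : Type u} [Field k] [CommRing A] [Algebra k A] (𝒜 : ℕ → Submodule k A)

/-- The ideal generated by the elements of positive degree. -/
abbrev positiveIdeal : Ideal A := Ideal.span {a : A | ∃ j, 0 < j ∧ a ∈ 𝒜 j}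

variable [GradedAlgebra 𝒜] (h𝒜 : 𝒜 0 = 1)

include h𝒜 in
lemma exists_sub_algebraMap_mem_positiveIdeal (a : A) :
    ∃ c : k, a - algebraMap k A c ∈ positiveIdeal 𝒜 := by
  induction a using DirectSum.Decomposition.inductionOn 𝒜 with
  | zero => exact ⟨0, by simp⟩
  | @homogeneous i a =>
    obtain ⟨a, ha⟩ := a
    obtain rfl | hi := Nat.eq_zero_or_pos i
    · rw [h𝒜] at ha
      obtain ⟨c, rfl⟩ := Submodule.mem_one.1 ha
      exact ⟨c, by rw [sub_self]; exact zero_mem _⟩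
    · refine ⟨0, ?_⟩
      rw [map_zero, sub_zero]
      exact Ideal.subset_span ⟨i, hi, ha⟩
  | add a b ha hb =>
    obtain ⟨c, hc⟩ := ha
    obtain ⟨d, hd⟩ := hb
    exact ⟨c + d, by simpa [add_sub_add_comm] using add_mem hc hd⟩

include h𝒜 in
lemma finite_of_smul_eq_zero {N : Type*} [AddCommGroup N] [Module A N] [Module k N]
    [IsScalarTower k A N] [Module.Finite A N] (h : ∀ a ∈ positiveIdeal 𝒜, ∀ x : N, a • x = 0) :
    Module.Finite k N := by
  obtain ⟨s, hs⟩ := Module.Finite.fg_top (R := A) (M := N)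
  refine ⟨s, eq_top_iff.2 fun x _ ↦ ?_⟩
  have hx : x ∈ Submodule.span A (s : Set N) := hs ▸ Submodule.mem_top
  induction hx using Submodule.span_induction with
  | mem x hx => exact Submodule.subset_span hx
  | zero => exact zero_mem _
  | add x y _ _ hx hy => exact add_mem (hx trivial) (hy trivial)
  | smul a x _ hx =>
    obtain ⟨c, hc⟩ := exists_sub_algebraMap_mem_positiveIdeal 𝒜 h𝒜 a
    have := h _ hc x
    rw [sub_smul, sub_eq_zero, algebraMap_smul] at this
    exact this ▸ Submodule.smul_mem _ c (hx trivial)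

include h𝒜 in
lemma isFiniteOver_of_smul_eq_zero (N : ModuleCat.{u} A) (hN : Module.Finite A N)
    (h : ∀ a ∈ positiveIdeal 𝒜, ∀ x : N, a • x = 0) : ModuleCat.isFiniteOver k A N := by
  let : Module k N := Module.compHom N (algebraMap k A)
  have : IsScalarTower k A N := IsScalarTower.of_algebraMap_smul fun _ _ ↦ rfl
  exact (ModuleCat.isFiniteOver_iff N).2 (finite_of_smul_eq_zero 𝒜 h𝒜 h)

include h𝒜 in
lemma isFiniteOver_tor (X : ModuleCat.{u} A) (n : ℕ)
    (h : Module.Finite A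
      (((Tor (ModuleCat A) n).obj X).obj (ModuleCat.of A (A ⧸ positiveIdeal 𝒜)))) :
    ModuleCat.isFiniteOver k A
      (((Tor (ModuleCat A) n).obj X).obj (ModuleCat.of A (A ⧸ positiveIdeal 𝒜))) :=
  isFiniteOver_of_smul_eq_zero 𝒜 h𝒜 _ h fun _ ha x ↦
    ModuleCat.smul_tor_quotient_eq_zero X _ ha n x

include h𝒜 in
/-- A finite-dimensional module killed by all elements of large degree is an iterated extension
of copies of the residue field. -/
theorem prop_of_finite (U : ObjectProperty (ModuleCat.{u} A)) [U.IsClosedUnderExtensions]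
    [U.IsClosedUnderIsomorphisms] [U.ContainsZero]
    (hU : U (ModuleCat.of A (A ⧸ positiveIdeal 𝒜))) (N₀ : ℕ)
    (N : ModuleCat.{u} A) (hN : ModuleCat.isFiniteOver k A N)
    (h : ∀ j, N₀ ≤ j → ∀ a ∈ 𝒜 j, ∀ x : N, a • x = 0) : U N := by
  let : Module k N := Module.compHom N (algebraMap k A)
  have : IsScalarTower k A N := IsScalarTower.of_algebraMap_smul fun _ _ ↦ rfl
  have hfin : Module.Finite k N := (ModuleCat.isFiniteOver_iff N).1 hN
  clear hN
  induction hd : Module.finrank k N using Nat.strong_induction_on generalizing N with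
  | _ d ih =>
  obtain hs | hs := subsingleton_or_nontrivial N
  · exact U.prop_of_isZero (ModuleCat.isZero_of_subsingleton N)
  obtain ⟨x, hx0, hx⟩ : ∃ x : N, x ≠ 0 ∧ ∀ a ∈ positiveIdeal 𝒜, a • x = 0 := by
    classical
    let p : ℕ → Prop := fun m ↦ ∃ a ∈ 𝒜 m, ∃ x : N, a • x ≠ 0
    have hp : ∀ m, p m → m ≤ N₀ := fun m ⟨a, ha, x, hx⟩ ↦
      le_of_not_ge fun hm ↦ hx (h m hm a ha x)
    have h0 : p 0 := by
      obtain ⟨x, hx⟩ := exists_ne (0 : N)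
      exact ⟨1, SetLike.GradedOne.one_mem, x, by rwa [one_smul]⟩
    obtain ⟨a, ha, x, hx⟩ := Nat.findGreatest_spec (Nat.zero_le N₀) h0
    refine ⟨a • x, hx, fun b hb ↦ ?_⟩
    induction hb using Submodule.span_induction with
    | zero => exact zero_smul _ _
    | add b c _ _ hb hc => rw [add_smul, hb, hc, add_zero]
    | smul c b _ hb => rw [smul_assoc, hb, smul_zero]
    | mem b hb =>
      obtain ⟨j, hj, hb⟩ := hb
      by_contra hne
      have hpj : p (j + Nat.findGreatest p N₀) :=
        ⟨b * a, SetLike.GradedMul.mul_mem hb ha, x, by rwa [mul_smul]⟩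
      have := Nat.le_findGreatest (hp _ hpj) hpj
      omega
  let L := Submodule.span A {x}
  have hker : LinearMap.ker (LinearMap.toSpanSingleton A N x) = positiveIdeal 𝒜 := by
    refine le_antisymm (fun a ha ↦ ?_) fun a ha ↦ hx a ha
    obtain ⟨c, hc⟩ := exists_sub_algebraMap_mem_positiveIdeal 𝒜 h𝒜 a
    have h1 := hx _ hc
    have h2 : a • x = 0 := ha
    rw [sub_smul, h2, zero_sub, neg_eq_zero, algebraMap_smul, smul_eq_zero] at h1
    simpa [h1.resolve_right hx0] using hc
  have hL : U (ModuleCat.of A L) := by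
    refine U.prop_of_iso (LinearEquiv.toModuleIso ?_) hU
    exact (Submodule.quotEquivOfEq _ _ hker.symm).trans
      ((LinearMap.quotKerEquivRange _).trans
        (LinearEquiv.ofEq _ _ (LinearMap.range_toSpanSingleton x)))
  have hQ : U (ModuleCat.of A (N ⧸ L)) := by
    refine ih (Module.finrank k (N ⧸ L)) ?_ _ ?_ inferInstance inferInstance rfl
    · let q : N →ₗ[k] N ⧸ L := L.mkQ.restrictScalars k
      have hq := q.finrank_range_add_finrank_ker
      rw [LinearMap.range_eq_top.2 (show Function.Surjective q from L.mkQ_surjective),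
        finrank_top] at hq
      have hker : 0 < Module.finrank k (LinearMap.ker q) := by
        have : Nontrivial (LinearMap.ker q) :=
          ⟨⟨x, (Submodule.Quotient.mk_eq_zero L).2 (Submodule.mem_span_singleton_self x)⟩, 0,
            fun h ↦ hx0 (congrArg Subtype.val h)⟩
        exact Module.finrank_pos
      omega
    · intro j hj a ha y
      obtain ⟨y, rfl⟩ := L.mkQ_surjective y
      exact (L.mkQ.map_smul a y).symm.trans (by rw [h j hj a ha y, map_zero])
  let S : ShortComplex (ModuleCat.{u} A) :=
    ShortComplex.mk (ModuleCat.ofHom L.subtype) (ModuleCat.ofHom L.mkQ) (by ext; simp)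
  have hS : S.ShortExact :=
    { exact := (ShortComplex.ShortExact.moduleCat_exact_iff_function_exact S).2
        (LinearMap.exact_subtype_mkQ L)
      mono_f := (ModuleCat.mono_iff_injective _).2 L.subtype_injective
      epi_g := (ModuleCat.epi_iff_surjective _).2 L.mkQ_surjective }
  exact U.prop_X₂_of_shortExact hS hL hQ

open ModuleCat MonoidalCategory

section

variable {B : Type u} [CommRing B] [Algebra k B] [Algebra A B] [IsScalarTower k A B]
  (ℬ : ℕ → Submodule k B) [GradedAlgebra ℬ]
  (hmap : ∀ (i : ℕ) (a : A), a ∈ 𝒜 i → algebraMap A B a ∈ ℬ i)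

include h𝒜 hmap in
/-- If `B ⊗ A ⧸ A₊` is finite then the elements of `B` of large degree lie in `A₊ B`. -/
lemma exists_forall_mem_map_positiveIdeal
    (hfin : Module.Finite A (B ⧸ (positiveIdeal 𝒜 • ⊤ : Submodule A B))) :
    ∃ N₀ : ℕ, ∀ j, N₀ ≤ j → ∀ b ∈ ℬ j, b ∈ (positiveIdeal 𝒜).map (algebraMap A B) := by
  classical
  set J := (positiveIdeal 𝒜).map (algebraMap A B) with hJ
  have hJhom : J.IsHomogeneous ℬ := by
    rw [hJ, Ideal.map_span]
    refine Ideal.homogeneous_span _ _ ?_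
    rintro _ ⟨a, ⟨j, -, ha⟩, rfl⟩
    exact ⟨j, hmap j a ha⟩
  have hJmem : ∀ {a}, a ∈ positiveIdeal 𝒜 → ∀ b, a • b ∈ J := fun ha b ↦ by
    rw [Algebra.smul_def]
    exact J.mul_mem_right _ (Ideal.mem_map_of_mem _ ha)
  let S : ℕ → Submodule A B := fun N ↦
    { carrier := {b | ∀ j, N ≤ j → (DirectSum.decompose ℬ b j : B) ∈ J}
      zero_mem' := fun j _ ↦ by simp
      add_mem' := fun hb hc j hj ↦ by
        simpa using add_mem (hb j hj) (hc j hj)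
      smul_mem' := fun a b hb j hj ↦ by
        obtain ⟨c, hc⟩ := exists_sub_algebraMap_mem_positiveIdeal 𝒜 h𝒜 a
        have h1 : a • b = (a - algebraMap k A c) • b + c • b := by
          rw [sub_smul, algebraMap_smul, sub_add_cancel]
        rw [h1, DirectSum.decompose_add, DirectSum.decompose_smul]
        refine add_mem (hJhom j (hJmem hc b)) ?_
        exact Submodule.smul_of_tower_mem J c (hb j hj) }
  have hSJ : ∀ N, (positiveIdeal 𝒜 • ⊤ : Submodule A B) ≤ S N := fun N ↦
    Submodule.smul_le.2 fun a ha b _ j _ ↦ hJhom j (hJmem ha b)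
  obtain ⟨s, hs⟩ := hfin.fg_top
  have hev : ∀ q ∈ s, ∀ᶠ N in Filter.atTop,
      q ∈ (S N).map (positiveIdeal 𝒜 • ⊤ : Submodule A B).mkQ := fun q _ ↦ by
    obtain ⟨b, rfl⟩ := Submodule.mkQ_surjective _ q
    filter_upwards [Filter.eventually_gt_atTop ((DirectSum.decompose ℬ b).support.sup id)]
      with N hN
    refine ⟨b, fun j hj ↦ ?_, rfl⟩
    have : j ∉ (DirectSum.decompose ℬ b).support := fun h ↦
      absurd (Finset.le_sup (f := id) h) (by simp only [id]; omega)
    rw [DFinsupp.notMem_support_iff.1 this]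
    exact zero_mem J
  obtain ⟨N, hN⟩ := ((Filter.eventually_all_finset s).2 hev).exists
  have htop : (S N).map (positiveIdeal 𝒜 • ⊤ : Submodule A B).mkQ = ⊤ :=
    eq_top_iff.2 (hs ▸ Submodule.span_le.2 hN)
  have hS : S N = ⊤ := by
    rw [← sup_eq_right.2 (hSJ N), ← Submodule.comap_map_mkQ, htop, Submodule.comap_top]
  refine ⟨N, fun j hj b hb ↦ ?_⟩
  have : b ∈ S N := hS ▸ Submodule.mem_top
  simpa [DirectSum.decompose_of_mem_same ℬ hb] using this j hj

include h𝒜 hmap in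
/-- The homology of `B ⊗ P`, for a projective resolution `P` of the residue field of `A`, is built
from the residue field of `B` by extensions as soon as `Tor^A(B, k)` is finite. -/
lemma prop_homology_baseChange (hℬ : ℬ 0 = 1)
    (hB : ∀ i : ℕ, Module.Finite A
      (((Tor (ModuleCat A) i).obj (of A B)).obj (of A (A ⧸ positiveIdeal 𝒜))))
    (P : ProjectiveResolution (of A (A ⧸ positiveIdeal 𝒜)))
    (U : ObjectProperty (ModuleCat.{u} B)) [U.IsClosedUnderExtensions]
    [U.IsClosedUnderIsomorphisms] [U.ContainsZero] (hU : U (of B (B ⧸ positiveIdeal ℬ))) (n : ℕ) :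
    U ((((ModuleCat.baseChange A B).mapHomologicalComplex _).obj P.complex).homology n) := by
  have hfin : Module.Finite A (B ⧸ (positiveIdeal 𝒜 • ⊤ : Submodule A B)) := by
    have e := ((tensorLeft (of A B)).leftDerivedZeroIsoSelf.app
      (of A (A ⧸ positiveIdeal 𝒜))).toLinearEquiv
    have : Module.Finite A (((tensorLeft (of A B)).leftDerived 0).obj
      (of A (A ⧸ positiveIdeal 𝒜))) := hB 0
    exact Module.Finite.equiv (e.trans (TensorProduct.tensorQuotEquivQuotSMul B (positiveIdeal 𝒜)))
  obtain ⟨N₀, hN₀⟩ := exists_forall_mem_map_positiveIdeal 𝒜 h𝒜 ℬ hmap hfin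
  let e := restrictScalarsHomologyIso (algebraMap A B) (baseChangeCompRestrictScalarsIso A B)
    P.complex n ≪≫ (P.isoLeftDerivedObj (tensorLeft (of A B)) n).symm
  refine prop_of_finite ℬ hℬ U hU N₀ _ ((isFiniteOver_iff_of_iso e).2
    (isFiniteOver_tor 𝒜 h𝒜 (of A B) n (hB n))) fun j hj b hb x ↦ ?_
  replace hb := hN₀ j hj b hb
  induction hb using Submodule.span_induction with
  | zero => exact zero_smul _ _
  | add b c _ _ hb hc => rw [add_smul, hb, hc, add_zero]
  | smul c b _ hb => rw [smul_assoc, hb, smul_zero]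
  | mem b hb =>
    obtain ⟨a, ha, rfl⟩ := hb
    refine e.toLinearEquiv.injective ((e.toLinearEquiv.map_smul a x).trans ?_)
    exact (smul_tor_quotient_eq_zero (of A B) _ ha n _).trans (map_zero e.toLinearEquiv).symm

end

end GradedAlgebra

end ConnectedGraded

/-- let `A` be a commutative ℕ-graded ring with `A₀ = k` a field, `B` a graded
`A`-algebra with `B₀ = k`. If `Tor_i^A(B, k)` is finite-dimensional over `k` for all `i`
(`B` is FT over `A`), and `M` is a `B`-module with `Tor_q^B(M, k)` finite-dimensional for all
`q`, then `Tor_n^A(M, k)` is finite-dimensional for all `n`. Here `k = A/A₊ = B/B₊`. -/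
theorem stmt10 {k A B : Type} [Field k] [CommRing A] [CommRing B]
    [Algebra k A] [Algebra k B] [Algebra A B] [IsScalarTower k A B]
    (𝒜 : ℕ → Submodule k A) [GradedAlgebra 𝒜] (h𝒜 : 𝒜 0 = 1)
    (ℬ : ℕ → Submodule k B) [GradedAlgebra ℬ] (hℬ : ℬ 0 = 1)
    (hmap : ∀ (i : ℕ) (a : A), a ∈ 𝒜 i → algebraMap A B a ∈ ℬ i)
    (hB : ∀ i : ℕ, Module.Finite A
      (((Tor (ModuleCat A) i).obj (ModuleCat.of A B)).obj
        (ModuleCat.of A (A ⧸ Ideal.span {a : A | ∃ j, 0 < j ∧ a ∈ 𝒜 j}))))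
    (M : Type) [AddCommGroup M] [Module A M] [Module B M] [IsScalarTower A B M]
    (hM : ∀ q : ℕ, Module.Finite B
      (((Tor (ModuleCat B) q).obj (ModuleCat.of B M)).obj
        (ModuleCat.of B (B ⧸ Ideal.span {b : B | ∃ j, 0 < j ∧ b ∈ ℬ j})))) :
    ∀ n : ℕ, Module.Finite A
      (((Tor (ModuleCat A) n).obj (ModuleCat.of A M)).obj
        (ModuleCat.of A (A ⧸ Ideal.span {a : A | ∃ j, 0 < j ∧ a ∈ 𝒜 j}))) := by
  intro n
  let P := ProjectiveResolution.of
    (ModuleCat.of A (A ⧸ GradedAlgebra.positiveIdeal 𝒜))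
  let F := ((ModuleCat.baseChange A B).mapHomologicalComplex _).obj P.complex
  have hF : ∀ i, Module.Flat B (F.X i) := fun i ↦
    inferInstanceAs (Module.Flat B (TensorProduct A B (P.complex.X i)))
  have h := ModuleCat.prop_homology_tensorLeft_map (ModuleCat.isFiniteOver k B)
    (fun q ↦ GradedAlgebra.isFiniteOver_tor ℬ hℬ (ModuleCat.of B M) q (hM q)) F hF
    (fun U _ _ _ hU i ↦ GradedAlgebra.prop_homology_baseChange 𝒜 h𝒜 ℬ hmap hℬ hB P U hU i) n
  let e := ModuleCat.restrictScalarsHomologyIso (algebraMap A B)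
    (ModuleCat.baseChangeCompTensorLeftIso A B M) P.complex n ≪≫
      (P.isoLeftDerivedObj (MonoidalCategory.tensorLeft (ModuleCat.of A M)) n).symm
  exact ModuleCat.finite_of_isFiniteOver (k := k) _ ((ModuleCat.isFiniteOver_iff_of_iso e).1 h)
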